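/- Let r ≥ 2, let α > 1 be a real number, let H be an r-graph of order h, and let H(k_1,…,k_h) be a fixed blow-up of H (with positive integers k_1,…,k_h). Then λ^(α)(Mon(H)) = λ^(α)(Mon(H(k_1,…,k_h))). -/

import Mathlib

/-!
Common definitions: `r`-uniform hypergraphs on vertex set `Fin n`, the polyform,
the parameter `λ^(α)`, degrees, properties of `r`-graphs, blow-ups, extremal
numbers and chromatic numbers.
-/

open Finset

/-- An `r`-uniform hypergraph on the vertex set `Fin n`. -/
structure HGraph (r n : ℕ) where
  edges : Finset (Finset (Fin n))
  uniform : ∀ e ∈ edges, e.card = r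

namespace HGraph

/-- The polyform `P_G(x) = r! ∑_{e ∈ E(G)} ∏_{i ∈ e} x_i`. -/
noncomputable def polyform {r n : ℕ} (G : HGraph r n) (x : Fin n → ℝ) : ℝ :=
  (r.factorial : ℝ) * ∑ e ∈ G.edges, ∏ i ∈ e, x i

/-- `λ^(α)(G)`: the maximum of the polyform over the unit sphere of `ℓ^α`. -/
noncomputable def lam {r n : ℕ} (α : ℝ) (G : HGraph r n) : ℝ :=
  sSup {y : ℝ | ∃ x : Fin n → ℝ, (∑ i, |x i| ^ α) = 1 ∧ y = G.polyform x}

/-- The degree of a vertex: the number of edges containing it. -/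
def degree {r n : ℕ} (G : HGraph r n) (v : Fin n) : ℕ :=
  (G.edges.filter (fun e => v ∈ e)).card

/-- Maximum degree `Δ(G)`. -/
def maxDeg {r n : ℕ} (G : HGraph r n) : ℕ :=
  Finset.univ.sup G.degree

/-- Minimum degree `δ(G)`. -/
noncomputable def minDeg {r n : ℕ} (G : HGraph r n) : ℕ :=
  sInf (Set.range G.degree)

/-- `G` is regular if all vertices have equal degrees. -/
def Regular {r n : ℕ} (G : HGraph r n) : Prop :=
  ∀ u v : Fin n, G.degree u = G.degree v

/-- The induced subgraph of `G` along the embedding `f`. -/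
def induce {r n m : ℕ} (G : HGraph r n) (f : Fin m ↪ Fin n) : HGraph r m where
  edges := Finset.univ.filter (fun e : Finset (Fin m) => e.map f ∈ G.edges)
  uniform := by
    intro e he
    rw [Finset.mem_filter] at he
    have h2 := G.uniform _ he.2
    rwa [Finset.card_map] at h2

/-- A property of `r`-graphs: a family closed under isomorphism (relabeling). -/
def IsProperty {r : ℕ} (P : ∀ n, Set (HGraph r n)) : Prop :=
  ∀ n : ℕ, ∀ σ : Equiv.Perm (Fin n), ∀ G ∈ P n, G.induce σ.toEmbedding ∈ P n

/-- A hereditary property: closed under taking induced subgraphs. -/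
def Hereditary {r : ℕ} (P : ∀ n, Set (HGraph r n)) : Prop :=
  ∀ n m : ℕ, ∀ f : Fin m ↪ Fin n, ∀ G ∈ P n, G.induce f ∈ P m

/-- A monotone property: closed under taking subgraphs. -/
def MonotoneProp {r : ℕ} (P : ∀ n, Set (HGraph r n)) : Prop :=
  ∀ n m : ℕ, ∀ f : Fin m ↪ Fin n, ∀ G ∈ P n, ∀ H : HGraph r m,
    (∀ e ∈ H.edges, e.map f ∈ G.edges) → H ∈ P m

/-- `B`, together with the projection `φ : V(B) → V(G)`, is (a copy of) the blow-up
`G(k 1, …, k n)` of `G`: the fiber over a vertex `i` of `G` has `k i` vertices, and the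
edges of `B` are exactly the transversals of the classes corresponding to edges of `G`. -/
def IsBlowup {r n N : ℕ} (G : HGraph r n) (k : Fin n → ℕ)
    (B : HGraph r N) (φ : Fin N → Fin n) : Prop :=
  (∀ i : Fin n, (Finset.univ.filter (fun v => φ v = i)).card = k i) ∧
  ∀ s : Finset (Fin N), s ∈ B.edges ↔ (Set.InjOn φ ↑s ∧ s.image φ ∈ G.edges)

/-- A multiplicative property: contains all blow-ups of all of its members. -/
def MultiplicativeProp {r : ℕ} (P : ∀ n, Set (HGraph r n)) : Prop :=
  ∀ n : ℕ, ∀ G ∈ P n, ∀ k : Fin n → ℕ, (∀ i, 0 < k i) →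
    ∀ N : ℕ, ∀ B : HGraph r N, ∀ φ : Fin N → Fin n, IsBlowup G k B φ → B ∈ P N

/-- The extremal number `ex(P, n)`: the maximum number of edges of a member of `P`
of order `n`. -/
noncomputable def exP {r : ℕ} (P : ∀ n, Set (HGraph r n)) (n : ℕ) : ℕ :=
  sSup {m : ℕ | ∃ G ∈ P n, G.edges.card = m}

/-- `λ^(α)(P, n)`: the maximum of `λ^(α)(G)` over members `G` of `P` of order `n`. -/
noncomputable def lamP {r : ℕ} (α : ℝ) (P : ∀ n, Set (HGraph r n)) (n : ℕ) : ℝ :=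
  sSup {y : ℝ | ∃ G ∈ P n, y = lam α G}

/-- The chromatic number: the least `k` such that the vertices can be `k`-colored
with no monochromatic edge (i.e. partitioned into `k` edgeless sets). -/
noncomputable def chrom {r n : ℕ} (G : HGraph r n) : ℕ :=
  sInf {k : ℕ | ∃ c : Fin n → Fin k, ∀ e ∈ G.edges, ¬ ∀ u ∈ e, ∀ w ∈ e, c u = c w}

/-- The weak chromatic number: the least `k` such that the vertices can be `k`-colored
with every edge getting `r` distinct colors (every class meets every edge in ≤ 1 vertex). -/
noncomputable def wchrom {r n : ℕ} (G : HGraph r n) : ℕ :=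
  sInf {k : ℕ | ∃ c : Fin n → Fin k, ∀ e ∈ G.edges, Set.InjOn c ↑e}

/-- `Mon(H)`: the (monotone, hereditary) property of all `r`-graphs containing no
subgraph isomorphic to `H`. -/
def MonP {r h : ℕ} (H : HGraph r h) : ∀ n, Set (HGraph r n) :=
  fun n => {G | ¬ ∃ f : Fin h ↪ Fin n, ∀ e ∈ H.edges, e.map f ∈ G.edges}

end HGraph

open HGraph

open Function in
/-- Marginalisation of a product weight along an injection of index sets. -/
lemma sum_comp_mul_prod_of_injective {V A M : Type*} [Fintype V] [Fintype A] [Fintype M]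
    [DecidableEq A] [DecidableEq M]
    {w : V → ℝ} (hw : ∑ v, w v = 1) {i : A → M} (hi : Injective i) (F : (A → V) → ℝ) :
    ∑ f : M → V, F (f ∘ i) * ∏ j, w (f j) = ∑ g : A → V, F g * ∏ a, w (g a) := by
  classical
  rw [← Finset.sum_fiberwise (g := fun f : M → V => f ∘ i)]
  refine Finset.sum_congr rfl fun g _ => ?_
  have hset : (univ.filter fun f : M → V => f ∘ i = g) =
      Fintype.piFinset fun j => univ.filter fun v => ∀ a, i a = j → g a = v := by
    ext f
    simp only [mem_filter, mem_univ, true_and, Fintype.mem_piFinset, funext_iff, comp_apply]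
    grind
  calc ∑ f with f ∘ i = g, F (f ∘ i) * ∏ j, w (f j)
      = ∑ f with f ∘ i = g, F g * ∏ j, w (f j) := by
        refine Finset.sum_congr rfl fun f hf => ?_
        rw [(mem_filter.1 hf).2]
    _ = F g * ∏ a, w (g a) := by
        rw [← Finset.mul_sum, hset,
          ← Finset.prod_univ_sum (fun j => univ.filter fun v => ∀ a, i a = j → g a = v)
            fun _ v => w v]
        congr 1
        refine (Fintype.prod_of_injective i hi _ _ (fun j hj => ?_) fun a => ?_).symm
        · rw [← hw]
          congr 1
          ext v
          simp only [mem_filter, mem_univ, true_and, iff_true]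
          exact fun a ha => absurd ⟨a, ha⟩ hj
        · have : (univ.filter fun v => ∀ b, i b = i a → g b = v) = {g a} := by
            ext v
            simp only [mem_filter, mem_univ, true_and, mem_singleton]
            exact ⟨fun h => (h a rfl).symm, fun h b hb => by rw [hi hb, h]⟩
          rw [this, Finset.sum_singleton]

lemma sum_prod_eq_one {V M : Type*} [Fintype V] [Fintype M] [DecidableEq M]
    {w : V → ℝ} (hw : ∑ v, w v = 1) : ∑ f : M → V, ∏ j, w (f j) = 1 := by
  have h := Finset.prod_univ_sum (fun _ : M => (univ : Finset V)) fun _ v => w v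
  rw [Fintype.piFinset_univ] at h
  rw [← h]
  simp [hw]

/-- The weight of the non-injective maps is at most the sum of the collision probabilities. -/
lemma sum_not_injective_le {V M : Type*} [Fintype V] [Fintype M]
    [DecidableEq V] [DecidableEq M] {w : V → ℝ} (hw0 : ∀ v, 0 ≤ w v) (hw : ∑ v, w v = 1) :
    ∑ f : M → V with ¬ Function.Injective f, ∏ j, w (f j) ≤
      (Fintype.card M : ℝ) ^ 2 * ∑ v, w v ^ 2 := by
  have hpos (f : M → V) : 0 ≤ ∏ j, w (f j) := Finset.prod_nonneg fun _ _ => hw0 _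
  have hpair (p : M × M) (hp : p.1 ≠ p.2) :
      ∑ f : M → V, (if f p.1 = f p.2 then (1 : ℝ) else 0) * ∏ j, w (f j) = ∑ v, w v ^ 2 := by
    have hi : Function.Injective ![p.1, p.2] := by
      intro a b
      fin_cases a <;> fin_cases b <;> simp [hp, hp.symm]
    have h := sum_comp_mul_prod_of_injective hw hi
      fun g : Fin 2 → V => if g 0 = g 1 then (1 : ℝ) else 0
    refine h.trans ?_
    rw [Fintype.sum_equiv (finTwoArrowEquiv V) _
      (fun q => (if q.1 = q.2 then (1 : ℝ) else 0) * (w q.1 * w q.2)) (by simp),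
      Fintype.sum_prod_type]
    simp [pow_two]
  calc ∑ f : M → V with ¬ Function.Injective f, ∏ j, w (f j)
      ≤ ∑ f : M → V, ∑ p : M × M with p.1 ≠ p.2,
          (if f p.1 = f p.2 then (1 : ℝ) else 0) * ∏ j, w (f j) := by
        rw [Finset.sum_filter]
        refine Finset.sum_le_sum fun f _ => ?_
        have hnn : ∀ p ∈ univ.filter fun p : M × M => p.1 ≠ p.2,
            0 ≤ (if f p.1 = f p.2 then (1 : ℝ) else 0) * ∏ j, w (f j) := fun p _ =>
          mul_nonneg (by split_ifs <;> norm_num) (hpos f)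
        by_cases hf : Function.Injective f
        · rw [if_neg (not_not.2 hf)]
          exact Finset.sum_nonneg hnn
        · rw [if_pos hf]
          simp only [Function.Injective, not_forall] at hf
          obtain ⟨a, b, hab, hne⟩ := hf
          refine le_trans ?_ (Finset.single_le_sum hnn (by simpa using hne : (a, b) ∈ _))
          simp [hab]
    _ = ∑ p : M × M with p.1 ≠ p.2, ∑ v, w v ^ 2 := by
        rw [Finset.sum_comm]
        exact Finset.sum_congr rfl fun p hp => hpair p (mem_filter.1 hp).2
    _ ≤ ∑ p : M × M, ∑ v, w v ^ 2 :=
        Finset.sum_le_univ_sum_of_nonneg fun _ => Finset.sum_nonneg fun _ _ => sq_nonneg _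
    _ = (Fintype.card M : ℝ) ^ 2 * ∑ v, w v ^ 2 := by
        simp [Fintype.card_prod, pow_two]

namespace HGraph

lemma card_filter_image_eq {r n : ℕ} (s : Finset (Fin n)) (hs : s.card = r) :
    (univ.filter fun g : Fin r → Fin n => univ.image g = s).card = r.factorial := by
  have hc : Fintype.card (Fin r ≃ s) = r.factorial := by
    rw [Fintype.card_equiv (Fintype.equivOfCardEq (by simp [hs])), Fintype.card_fin]
  rw [← hc, ← Finset.card_univ]
  symm
  refine Finset.card_bij (fun e _ i => (e i : Fin n)) (fun e _ => ?_) (fun e _ e' _ h => ?_)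
    fun g hg => ?_
  · simp only [mem_filter, mem_univ, true_and]
    ext v
    simp only [mem_image, mem_univ, true_and]
    exact ⟨fun ⟨i, hi⟩ => hi ▸ (e i).2, fun hv => ⟨e.symm ⟨v, hv⟩, by simp⟩⟩
  · ext i
    exact congrArg Fin.val (congrFun h i)
  · have hg' : univ.image g = s := (mem_filter.1 hg).2
    have hmem (i : Fin r) : g i ∈ s := hg' ▸ mem_image_of_mem g (mem_univ i)
    have hsurj : Function.Surjective fun i => (⟨g i, hmem i⟩ : s) := by
      rintro ⟨v, hv⟩
      rw [← hg'] at hv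
      obtain ⟨i, -, rfl⟩ := mem_image.1 hv
      exact ⟨i, rfl⟩
    exact ⟨Equiv.ofBijective _ ((Fintype.bijective_iff_surjective_and_card _).2
      ⟨hsurj, by simp [hs]⟩), mem_univ _, rfl⟩

/-- The polyform as a sum over ordered edges. -/
lemma polyform_eq_sum {r n : ℕ} (G : HGraph r n) (w : Fin n → ℝ) :
    G.polyform w =
      ∑ g : Fin r → Fin n, (if univ.image g ∈ G.edges then (1 : ℝ) else 0) * ∏ i, w (g i) := by
  simp only [ite_mul, one_mul, zero_mul]
  rw [← Finset.sum_filter, ← Finset.sum_fiberwise_of_maps_to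
    (s := univ.filter fun g : Fin r → Fin n => univ.image g ∈ G.edges) (t := G.edges)
    (g := fun g => univ.image g) fun g hg => (mem_filter.1 hg).2, polyform, Finset.mul_sum]
  refine Finset.sum_congr rfl fun s hs => ?_
  have hset : ((univ.filter fun g : Fin r → Fin n => univ.image g ∈ G.edges).filter
      fun g => univ.image g = s) = univ.filter fun g : Fin r → Fin n => univ.image g = s := by
    ext g
    simp only [mem_filter, mem_univ, true_and]
    exact ⟨fun h => h.2, fun h => ⟨h ▸ hs, h⟩⟩
  rw [hset, ← card_filter_image_eq s (G.uniform s hs), ← nsmul_eq_mul, ← Finset.sum_const]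
  refine Finset.sum_congr rfl fun g hg => ?_
  have hg' : univ.image g = s := (mem_filter.1 hg).2
  have hinj : Set.InjOn g (univ : Finset (Fin r)) := by
    rw [← Finset.card_image_iff, hg', G.uniform s hs, Finset.card_fin]
  rw [← hg', Finset.prod_image hinj]

end HGraph

lemma card_not_injective_le (t n : ℕ) :
    ((univ.filter fun f : Fin t → Fin n => ¬ Function.Injective f).card : ℝ) * n ≤
      (t : ℝ) ^ 2 * (n : ℝ) ^ t := by
  rcases Nat.eq_zero_or_pos n with rfl | hn
  · simp only [CharP.cast_eq_zero, mul_zero]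
    positivity
  have hn' : (0 : ℝ) < n := by exact_mod_cast hn
  have h := sum_not_injective_le (M := Fin t) (V := Fin n) (w := fun _ => (n : ℝ)⁻¹)
    (fun _ => by positivity) (by simp [hn'.ne'])
  simp only [Finset.prod_const, Finset.sum_const, Finset.card_univ, Fintype.card_fin,
    nsmul_eq_mul] at h
  have h1 : ((univ.filter fun f : Fin t → Fin n => ¬ Function.Injective f).card : ℝ) *
      (n : ℝ)⁻¹ ^ t ≤ (t : ℝ) ^ 2 * (n : ℝ)⁻¹ := by
    have hsq : (n : ℝ) * (n : ℝ)⁻¹ ^ 2 = (n : ℝ)⁻¹ := by field_simp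
    rwa [hsq] at h
  rw [inv_pow, ← div_eq_mul_inv, ← div_eq_mul_inv, div_le_div_iff₀ (by positivity) hn'] at h1
  exact h1

/-- The box theorem of Erdős: a dense set of `h`-tuples contains a box with sides of given size. -/
lemma exists_box (t h : ℕ) : ∀ ε : ℝ, 0 < ε → ∃ n₀ : ℕ, ∀ n ≥ n₀,
    ∀ S : Finset (Fin h → Fin n), ε * (n : ℝ) ^ h ≤ S.card →
      ∃ T : Fin h → Fin (t + 1) → Fin n, (∀ i, Function.Injective (T i)) ∧
        ∀ c : Fin h → Fin (t + 1), (fun i => T i (c i)) ∈ S := by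
  induction h with
  | zero =>
    intro ε hε
    refine ⟨0, fun n _ S hS => ⟨fun i => i.elim0, fun i => i.elim0, fun c => ?_⟩⟩
    have hpos : (0 : ℝ) < S.card := lt_of_lt_of_le (by simpa using hε) hS
    obtain ⟨s, hs⟩ := Finset.card_pos.1 (by exact_mod_cast hpos : 0 < S.card)
    convert hs
  | succ h ih =>
    intro ε hε
    set δ : ℝ := ε ^ (t + 1) / 2 with hδ
    have hδ0 : 0 < δ := by positivity
    obtain ⟨n₁, hn₁⟩ := ih δ hδ0
    obtain ⟨n₂, hn₂⟩ := exists_nat_gt (((t + 1 : ℕ) : ℝ) ^ 2 / δ)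
    refine ⟨max n₁ (max n₂ 1), fun n hn S hS => ?_⟩
    have hn0 : (0 : ℝ) < n := by exact_mod_cast (by omega : 0 < n)
    have hlarge : ((t + 1 : ℕ) : ℝ) ^ 2 < δ * n := by
      rw [div_lt_iff₀ hδ0] at hn₂
      have : (n₂ : ℝ) ≤ n := by exact_mod_cast (by omega : n₂ ≤ n)
      nlinarith
    let a (x : Fin n) (y : Fin h → Fin n) : ℝ :=
      if (Fin.cons x y : Fin (h + 1) → Fin n) ∈ S then 1 else 0
    have ha0 (x y) : 0 ≤ a x y := by dsimp only [a]; split_ifs <;> norm_num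
    have ha1 (x y) : a x y ≤ 1 := by dsimp only [a]; split_ifs <;> norm_num
    have hcard : ∑ y, ∑ x, a x y = S.card := by
      rw [Finset.sum_comm, ← Fintype.sum_prod_type' (f := a)]
      refine (Fintype.sum_equiv (Fin.consEquiv fun _ => Fin n) _
        (fun f : Fin (h + 1) → Fin n => if f ∈ S then (1 : ℝ) else 0) fun p => rfl).trans ?_
      simp
    have hpow : (∑ y, ∑ x, a x y) ^ (t + 1) ≤ ((n : ℝ) ^ h) ^ t *
        ∑ T : Fin (t + 1) → Fin n, ∑ y, ∏ j, a (T j) y := by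
      have := pow_sum_le_card_mul_sum_pow (s := (univ : Finset (Fin h → Fin n)))
        (f := fun y => ∑ x, a x y) (fun y _ => Finset.sum_nonneg fun x _ => ha0 x y) t
      have hswap : ∑ y, (∑ x, a x y) ^ (t + 1) =
          ∑ T : Fin (t + 1) → Fin n, ∑ y, ∏ j, a (T j) y := by
        simp only [Fintype.sum_pow]
        exact Finset.sum_comm
      rw [hswap] at this
      simpa using this
    have hcount (T : Fin (t + 1) → Fin n) : ∑ y, ∏ j, a (T j) y =
        (univ.filter fun y => ∀ j, (Fin.cons (T j) y : Fin (h + 1) → Fin n) ∈ S).card := by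
      simp only [a, Finset.prod_ite_zero, Finset.prod_const_one]
      simp
    obtain ⟨T, hT, hTS⟩ : ∃ T : Fin (t + 1) → Fin n, Function.Injective T ∧
        δ * (n : ℝ) ^ h ≤ ∑ y, ∏ j, a (T j) y := by
      by_contra! hcon
      have hup : ∑ T : Fin (t + 1) → Fin n, ∑ y, ∏ j, a (T j) y ≤
          ∑ T : Fin (t + 1) → Fin n, (δ * (n : ℝ) ^ h +
            if ¬ Function.Injective T then (n : ℝ) ^ h else 0) := by
        refine Finset.sum_le_sum fun T _ => ?_
        by_cases hT : Function.Injective T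
        · simpa [hT] using (hcon T hT).le
        · rw [if_pos hT]
          have : ∑ y, ∏ j, a (T j) y ≤ ∑ y : Fin h → Fin n, (1 : ℝ) :=
            Finset.sum_le_sum fun y _ =>
              Finset.prod_le_one (fun j _ => ha0 _ _) fun j _ => ha1 _ _
          have h2 : ∑ y : Fin h → Fin n, (1 : ℝ) = (n : ℝ) ^ h := by simp
          have h3 : 0 ≤ δ * (n : ℝ) ^ h := by positivity
          linarith
      rw [Finset.sum_add_distrib, ← Finset.sum_filter] at hup
      simp only [Finset.sum_const, Finset.card_univ, Fintype.card_fun, Fintype.card_fin,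
        nsmul_eq_mul, Nat.cast_pow] at hup
      have hni := card_not_injective_le (t + 1) n
      set c : ℝ := ((univ.filter fun f : Fin (t + 1) → Fin n =>
        ¬ Function.Injective f).card : ℝ)
      have hc : c < δ * (n : ℝ) ^ (t + 1) := by
        have : c * n < δ * (n : ℝ) ^ (t + 1) * n := by
          calc c * n ≤ ((t + 1 : ℕ) : ℝ) ^ 2 * (n : ℝ) ^ (t + 1) := hni
            _ < δ * n * (n : ℝ) ^ (t + 1) := by gcongr
            _ = _ := by ring
        exact lt_of_mul_lt_mul_right this hn0.le
      have hlow : (ε * (n : ℝ) ^ (h + 1)) ^ (t + 1) ≤ (∑ y, ∑ x, a x y) ^ (t + 1) := by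
        rw [hcard]
        gcongr
      have hfin : (ε * (n : ℝ) ^ (h + 1)) ^ (t + 1) <
          ((n : ℝ) ^ h) ^ t * (2 * δ * (n : ℝ) ^ (t + 1) * (n : ℝ) ^ h) := by
        refine (hlow.trans hpow).trans_lt ?_
        have : 0 < (n : ℝ) ^ h := by positivity
        gcongr
        nlinarith
      have heq : (ε * (n : ℝ) ^ (h + 1)) ^ (t + 1) =
          ((n : ℝ) ^ h) ^ t * (2 * δ * (n : ℝ) ^ (t + 1) * (n : ℝ) ^ h) := by
        rw [hδ]
        ring
      exact hfin.ne heq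
    rw [hcount] at hTS
    obtain ⟨T', hT', hbox⟩ := hn₁ n (by omega) _ hTS
    refine ⟨Fin.cons T T', fun i => ?_, fun c => ?_⟩
    · refine Fin.cases ?_ (fun i => ?_) i
      · simpa using hT
      · simpa using hT' i
    · have := (mem_filter.1 (hbox fun i => c i.succ)).2 (c 0)
      convert this using 1
      funext i
      refine Fin.cases ?_ (fun i => ?_) i <;> simp

namespace HGraph

lemma edges_subset_powersetCard {r n : ℕ} (G : HGraph r n) :
    G.edges ⊆ powersetCard r univ :=
  fun e he => mem_powersetCard.2 ⟨subset_univ e, G.uniform e he⟩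

lemma card_edges_le_choose {r n : ℕ} (G : HGraph r n) : G.edges.card ≤ n.choose r := by
  simpa using card_le_card G.edges_subset_powersetCard

lemma bddAbove_card_edges {r : ℕ} (P : ∀ n, Set (HGraph r n)) (n : ℕ) :
    BddAbove {m : ℕ | ∃ G ∈ P n, G.edges.card = m} :=
  ⟨n.choose r, by rintro _ ⟨G, -, rfl⟩; exact G.card_edges_le_choose⟩

lemma card_edges_le_exP {r : ℕ} {P : ∀ n, Set (HGraph r n)} {n : ℕ} {G : HGraph r n}
    (hG : G ∈ P n) : G.edges.card ≤ exP P n :=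
  le_csSup (bddAbove_card_edges P n) ⟨G, hG, rfl⟩

lemma exists_card_edges_eq_exP {r : ℕ} {P : ∀ n, Set (HGraph r n)} {n : ℕ}
    (h : (P n).Nonempty) : ∃ G ∈ P n, G.edges.card = exP P n := by
  obtain ⟨G, hG⟩ := h
  exact Nat.sSup_mem (s := {m : ℕ | ∃ G ∈ P n, G.edges.card = m}) ⟨_, G, hG, rfl⟩
    (bddAbove_card_edges P n)

lemma exP_eq_zero_of_not_nonempty {r : ℕ} {P : ∀ n, Set (HGraph r n)} {n : ℕ}
    (h : ¬ (P n).Nonempty) : exP P n = 0 := by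
  rw [Set.not_nonempty_iff_eq_empty] at h
  simp [exP, h]

lemma exP_le_exP {r : ℕ} {P Q : ∀ n, Set (HGraph r n)} {n : ℕ} (h : P n ⊆ Q n) :
    exP P n ≤ exP Q n := by
  by_cases hP : (P n).Nonempty
  · obtain ⟨G, hG, hcard⟩ := exists_card_edges_eq_exP hP
    exact hcard ▸ card_edges_le_exP (h hG)
  · simp [exP_eq_zero_of_not_nonempty hP]

/-- The density `ex(P, m) / C(m, r)`. -/
noncomputable def exDensity {r : ℕ} (P : ∀ n, Set (HGraph r n)) (m : ℕ) : ℝ :=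
  exP P m / m.choose r

lemma exDensity_nonneg {r : ℕ} (P : ∀ n, Set (HGraph r n)) (m : ℕ) : 0 ≤ exDensity P m := by
  unfold exDensity
  positivity

open Classical in
/-- Sampling `m` vertices independently according to `w` bounds the polyform at `w` by the
density of `P` at order `m` plus the probability that the sample does not induce a member. -/
lemma polyform_le_exDensity_add {r n m : ℕ} (P : ∀ n, Set (HGraph r n)) (G : HGraph r n)
    (hm : r ≤ m) {w : Fin n → ℝ} (hw0 : ∀ v, 0 ≤ w v) (hw : ∑ v, w v = 1) :
    G.polyform w ≤ exDensity P m +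
      ∑ f : Fin m → Fin n with ∀ hf : Function.Injective f, G.induce ⟨f, hf⟩ ∉ P m,
        ∏ j, w (f j) := by
  have hC : (0 : ℝ) < m.choose r := by exact_mod_cast Nat.choose_pos hm
  have hpos (f : Fin m → Fin n) : 0 ≤ ∏ j, w (f j) := Finset.prod_nonneg fun _ _ => hw0 _
  have hedge (e : Finset (Fin m)) (he : e ∈ powersetCard r univ) :
      ∑ f : Fin m → Fin n, (if e.image f ∈ G.edges then (1 : ℝ) else 0) * ∏ j, w (f j) =
        G.polyform w := by
    have hcard := (mem_powersetCard.1 he).2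
    rw [polyform_eq_sum, ← sum_comp_mul_prod_of_injective hw (e.orderEmbOfFin hcard).injective]
    refine Finset.sum_congr rfl fun f _ => ?_
    rw [← Finset.image_image, Finset.image_orderEmbOfFin_univ]
  have hsum : (m.choose r : ℝ) * G.polyform w =
      ∑ f : Fin m → Fin n, (((powersetCard r univ).filter fun e : Finset (Fin m) =>
        e.image f ∈ G.edges).card : ℝ) * ∏ j, w (f j) := by
    calc (m.choose r : ℝ) * G.polyform w
        = ∑ e ∈ powersetCard r (univ : Finset (Fin m)), G.polyform w := by simp
      _ = ∑ e ∈ powersetCard r (univ : Finset (Fin m)), ∑ f : Fin m → Fin n,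
            (if e.image f ∈ G.edges then (1 : ℝ) else 0) * ∏ j, w (f j) :=
          Finset.sum_congr rfl fun e he => (hedge e he).symm
      _ = _ := by
          rw [Finset.sum_comm]
          refine Finset.sum_congr rfl fun f _ => ?_
          rw [← Finset.sum_mul]
          simp
  have hle : (m.choose r : ℝ) * G.polyform w ≤
      ∑ f : Fin m → Fin n, ((exP P m : ℝ) * ∏ j, w (f j) +
        if ∀ hf : Function.Injective f, G.induce ⟨f, hf⟩ ∉ P m
          then (m.choose r : ℝ) * ∏ j, w (f j) else 0) := by
    rw [hsum]
    refine Finset.sum_le_sum fun f _ => ?_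
    split_ifs with hbad
    · have : (((powersetCard r univ).filter fun e : Finset (Fin m) =>
          e.image f ∈ G.edges).card : ℝ) ≤ m.choose r := by
        exact_mod_cast (card_filter_le _ _).trans_eq (by simp)
      have h0 : 0 ≤ (exP P m : ℝ) * ∏ j, w (f j) := mul_nonneg (by positivity) (hpos f)
      have := mul_le_mul_of_nonneg_right this (hpos f)
      linarith
    · push Not at hbad
      obtain ⟨hf, hmem⟩ := hbad
      rw [add_zero]
      refine mul_le_mul_of_nonneg_right ?_ (hpos f)
      refine Nat.cast_le.2 ((card_le_card fun e he => ?_).trans (card_edges_le_exP hmem))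
      have := (mem_filter.1 he).2
      rw [← Function.Embedding.coeFn_mk f hf, ← Finset.map_eq_image] at this
      exact mem_filter.2 ⟨mem_univ _, this⟩
  rw [Finset.sum_add_distrib, ← Finset.mul_sum, sum_prod_eq_one hw, mul_one,
    ← Finset.sum_filter, ← Finset.mul_sum] at hle
  refine le_of_mul_le_mul_left (hle.trans_eq ?_) hC
  rw [exDensity]
  field_simp

end HGraph

namespace HGraph

lemma hereditary_monP {r h : ℕ} (H : HGraph r h) : Hereditary (MonP H) := by
  rintro n m f G hG ⟨g, hg⟩
  refine hG ⟨g.trans f, fun e he => ?_⟩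
  rw [← Finset.map_map]
  exact (mem_filter.1 (hg e he)).2

lemma polyform_le_of_mem {r n m : ℕ} {P : ∀ n, Set (HGraph r n)} (hP : Hereditary P)
    {G : HGraph r n} (hG : G ∈ P n) (hm : r ≤ m) {w : Fin n → ℝ} (hw0 : ∀ v, 0 ≤ w v)
    (hw : ∑ v, w v = 1) :
    G.polyform w ≤ exDensity P m + (m : ℝ) ^ 2 * ∑ v, w v ^ 2 := by
  classical
  have h := sum_not_injective_le (M := Fin m) hw0 hw
  rw [Fintype.card_fin] at h
  refine (polyform_le_exDensity_add P G hm hw0 hw).trans (add_le_add_right (le_trans ?_ h) _)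
  refine Finset.sum_le_sum_of_subset_of_nonneg (fun f hf => ?_)
    fun f _ _ => Finset.prod_nonneg fun _ _ => hw0 _
  simp only [mem_filter, mem_univ, true_and] at hf ⊢
  exact fun hinj => hf hinj (hP _ _ _ G hG)

open Classical in
/-- The injective homomorphisms from `H` to `G`. -/
noncomputable def copies {r h n : ℕ} (H : HGraph r h) (G : HGraph r n) :
    Finset (Fin h → Fin n) :=
  univ.filter fun g => Function.Injective g ∧ ∀ e ∈ H.edges, e.image g ∈ G.edges

lemma mem_copies {r h n : ℕ} {H : HGraph r h} {G : HGraph r n} {g : Fin h → Fin n} :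
    g ∈ copies H G ↔ Function.Injective g ∧ ∀ e ∈ H.edges, e.image g ∈ G.edges := by
  simp [copies]

lemma polyform_le_copies {r h n m : ℕ} (H : HGraph r h) (G : HGraph r n) (hm : r ≤ m)
    {w : Fin n → ℝ} (hw0 : ∀ v, 0 ≤ w v) (hw : ∑ v, w v = 1) :
    G.polyform w ≤ exDensity (MonP H) m + ((m : ℝ) ^ 2 * ∑ v, w v ^ 2 +
      Fintype.card (Fin h ↪ Fin m) * ∑ g ∈ copies H G, ∏ i, w (g i)) := by
  classical
  have hpos (f : Fin m → Fin n) : 0 ≤ ∏ j, w (f j) := Finset.prod_nonneg fun _ _ => hw0 _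
  have hninj := sum_not_injective_le (M := Fin m) hw0 hw
  rw [Fintype.card_fin] at hninj
  have hcop : ∑ f : Fin m → Fin n, ∑ ι : Fin h ↪ Fin m,
      (if f ∘ ι ∈ copies H G then (1 : ℝ) else 0) * ∏ j, w (f j) =
      Fintype.card (Fin h ↪ Fin m) * ∑ g ∈ copies H G, ∏ i, w (g i) := by
    rw [Finset.sum_comm, ← nsmul_eq_mul, ← Finset.card_univ, ← Finset.sum_const]
    refine Finset.sum_congr rfl fun ι _ => ?_
    refine (sum_comp_mul_prod_of_injective hw ι.injective
      fun g => if g ∈ copies H G then (1 : ℝ) else 0).trans ?_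
    simp
  refine (polyform_le_exDensity_add (MonP H) G hm hw0 hw).trans (add_le_add_right ?_ _)
  refine le_trans ?_ (add_le_add hninj hcop.le)
  rw [Finset.sum_filter, Finset.sum_filter, ← Finset.sum_add_distrib]
  refine Finset.sum_le_sum fun f _ => ?_
  have hnn : ∀ ι ∈ (univ : Finset (Fin h ↪ Fin m)),
      0 ≤ (if f ∘ ι ∈ copies H G then (1 : ℝ) else 0) * ∏ j, w (f j) := fun ι _ =>
    mul_nonneg (by split_ifs <;> norm_num) (hpos f)
  have hnn' := Finset.sum_nonneg hnn
  by_cases hf : Function.Injective f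
  · rw [if_neg (not_not.2 hf), zero_add]
    split_ifs with hbad
    · have := hbad hf
      simp only [MonP, Set.mem_ofPred_eq, not_not] at this
      obtain ⟨ι, hι⟩ := this
      refine le_trans ?_ (Finset.single_le_sum hnn (mem_univ ι))
      rw [if_pos, one_mul]
      refine mem_copies.2 ⟨hf.comp ι.injective, fun e he => ?_⟩
      have := (mem_filter.1 (hι e he)).2
      rwa [Finset.map_eq_image, Finset.map_eq_image, Finset.image_image] at this
    · exact hnn'
  · rw [if_pos hf]
    have := hpos f
    split_ifs <;> linarith

/-- A large enough complete system of copies of `H` contains every blow-up of `H`. -/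
lemma not_mem_monP_of_box {r h n N : ℕ} (hr : 2 ≤ r) {H : HGraph r h} {k : Fin h → ℕ}
    {B : HGraph r N} {φ : Fin N → Fin h} (hB : IsBlowup H k B φ) {G : HGraph r n}
    {T : Fin h → Fin (N + 1) → Fin n} (hT : ∀ i, Function.Injective (T i))
    (hbox : ∀ c : Fin h → Fin (N + 1), (fun i => T i (c i)) ∈ copies H G) :
    G ∉ MonP B n := by
  have hinj : Function.Injective fun v => T (φ v) v.castSucc := by
    intro u v huv
    by_cases hφ : φ u = φ v
    · simp only [hφ] at huv
      exact Fin.castSucc_injective _ (hT _ huv)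
    · exfalso
      have := (mem_copies.1 (hbox fun i => if i = φ u then u.castSucc else v.castSucc)).1
      refine hφ (this ?_)
      simpa [Ne.symm hφ] using huv
  refine not_not.2 ⟨⟨_, hinj⟩, fun e he => ?_⟩
  obtain ⟨hφ, hmem⟩ := (hB.2 e).1 he
  have hne : e.Nonempty := card_pos.1 (by rw [B.uniform e he]; omega)
  obtain ⟨v₀, -⟩ := hne
  have : Nonempty (Fin N) := ⟨v₀⟩
  have := (mem_copies.1 (hbox fun i => (Function.invFunOn φ e i).castSucc)).2 _ hmem
  convert this using 1
  rw [Finset.map_eq_image, Finset.image_image]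
  refine Finset.image_congr fun v hv => ?_
  simp only [Function.Embedding.coeFn_mk, Function.comp_apply]
  rw [hφ.leftInvOn_invFunOn hv]

/-- A `B`-free graph, where `B` is a blow-up of `H`, has few copies of `H`. -/
lemma exists_card_copies_lt {r h N : ℕ} (hr : 2 ≤ r) {H : HGraph r h} {k : Fin h → ℕ}
    {B : HGraph r N} {φ : Fin N → Fin h} (hB : IsBlowup H k B φ) {ε : ℝ} (hε : 0 < ε) :
    ∃ n₀ : ℕ, ∀ n ≥ n₀, ∀ G ∈ MonP B n, ((copies H G).card : ℝ) < ε * (n : ℝ) ^ h := by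
  obtain ⟨n₀, hn₀⟩ := exists_box N h ε hε
  refine ⟨n₀, fun n hn G hG => ?_⟩
  by_contra! hcon
  obtain ⟨T, hT, hbox⟩ := hn₀ n hn _ hcon
  exact not_mem_monP_of_box hr hB hT hbox hG

lemma monP_subset_of_isBlowup {r h N : ℕ} {H : HGraph r h} {k : Fin h → ℕ}
    (hk : ∀ i, 0 < k i) {B : HGraph r N} {φ : Fin N → Fin h} (hB : IsBlowup H k B φ) (n : ℕ) :
    MonP H n ⊆ MonP B n := by
  have hsurj (i : Fin h) : ∃ v, φ v = i := by
    obtain ⟨v, hv⟩ := card_pos.1 ((hB.1 i).symm ▸ hk i)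
    exact ⟨v, (mem_filter.1 hv).2⟩
  choose s hs using hsurj
  have hsinj : Function.Injective s := Function.LeftInverse.injective hs
  rintro G hG ⟨f, hf⟩
  refine hG ⟨(⟨s, hsinj⟩ : Fin h ↪ Fin N).trans f, fun e he => ?_⟩
  rw [← Finset.map_map]
  refine hf _ ((hB.2 _).2 ⟨?_, ?_⟩)
  · intro u hu v hv huv
    simp only [coe_map, Function.Embedding.coeFn_mk, Set.mem_image] at hu hv
    obtain ⟨a, -, rfl⟩ := hu
    obtain ⟨b, -, rfl⟩ := hv
    rw [hs, hs] at huv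
    rw [huv]
  · rw [Finset.map_eq_image, Finset.image_image]
    have : φ ∘ s = id := funext hs
    simpa [this] using he

lemma polyform_const {r n : ℕ} (G : HGraph r n) (c : ℝ) :
    G.polyform (fun _ => c) = r.factorial * G.edges.card * c ^ r := by
  rw [polyform, Finset.sum_congr rfl fun e he => by rw [Finset.prod_const, G.uniform e he]]
  simp [mul_assoc]

lemma polyform_mul {r n : ℕ} (G : HGraph r n) (c : ℝ) (w : Fin n → ℝ) :
    G.polyform (fun i => c * w i) = c ^ r * G.polyform w := by
  rw [polyform, polyform, Finset.sum_congr rfl fun e he => by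
    rw [Finset.prod_mul_distrib, Finset.prod_const, G.uniform e he], ← Finset.mul_sum]
  ring

lemma polyform_le_polyform_abs {r n : ℕ} (G : HGraph r n) (x : Fin n → ℝ) :
    G.polyform x ≤ G.polyform fun i => |x i| := by
  unfold polyform
  refine mul_le_mul_of_nonneg_left (Finset.sum_le_sum fun e _ => ?_) (by positivity)
  rw [← Finset.abs_prod]
  exact le_abs_self _

lemma abs_le_one_of_sum_rpow_eq_one {n : ℕ} {α : ℝ} (hα : 0 < α) {x : Fin n → ℝ}
    (hx : ∑ i, |x i| ^ α = 1) (i : Fin n) : |x i| ≤ 1 := by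
  by_contra! h
  have h1 := Finset.single_le_sum (f := fun i => |x i| ^ α) (fun i _ => by positivity)
    (mem_univ i)
  have := Real.one_lt_rpow h hα
  linarith

lemma polyform_le_factorial_mul_choose {r n : ℕ} (G : HGraph r n) {α : ℝ} (hα : 0 < α)
    {x : Fin n → ℝ} (hx : ∑ i, |x i| ^ α = 1) :
    G.polyform x ≤ r.factorial * n.choose r := by
  refine (G.polyform_le_polyform_abs x).trans ?_
  unfold polyform
  gcongr
  calc ∑ e ∈ G.edges, ∏ i ∈ e, |x i| ≤ ∑ e ∈ G.edges, (1 : ℝ) :=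
        Finset.sum_le_sum fun e _ => Finset.prod_le_one (fun _ _ => abs_nonneg _)
          fun i _ => abs_le_one_of_sum_rpow_eq_one hα hx i
    _ ≤ n.choose r := by
        simpa using G.card_edges_le_choose

lemma polyform_le_lam {r n : ℕ} (G : HGraph r n) {α : ℝ} (hα : 0 < α)
    {x : Fin n → ℝ} (hx : ∑ i, |x i| ^ α = 1) : G.polyform x ≤ lam α G :=
  le_csSup ⟨r.factorial * n.choose r, by
    rintro _ ⟨y, hy, rfl⟩; exact G.polyform_le_factorial_mul_choose hα hy⟩ ⟨x, hx, rfl⟩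

lemma lam_le_lamP {r n : ℕ} {P : ∀ n, Set (HGraph r n)} {G : HGraph r n} (hG : G ∈ P n)
    {α : ℝ} (hα : 0 < α) : lam α G ≤ lamP α P n := by
  refine le_csSup ⟨r.factorial * n.choose r, ?_⟩ ⟨G, hG, rfl⟩
  rintro _ ⟨G', -, rfl⟩
  refine Real.sSup_le ?_ (by positivity)
  rintro _ ⟨y, hy, rfl⟩
  exact G'.polyform_le_factorial_mul_choose hα hy

/-- The uniform vector shows that `λ^(α)` is at least the edge density. -/
lemma factorial_mul_exP_div_le {r n : ℕ} (P : ∀ n, Set (HGraph r n)) {α : ℝ} (hα : 0 < α)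
    (hn : 0 < n) :
    r.factorial * exP P n / (n : ℝ) ^ r ≤ lamP α P n * (n : ℝ) ^ ((r : ℝ) / α - r) := by
  have hn' : (0 : ℝ) < n := by exact_mod_cast hn
  by_cases hP : (P n).Nonempty
  · obtain ⟨G, hG, hcard⟩ := exists_card_edges_eq_exP hP
    have hx : ∑ i : Fin n, |(n : ℝ) ^ (-(1 / α))| ^ α = 1 := by
      rw [abs_of_pos (by positivity), ← Real.rpow_mul hn'.le]
      have : -(1 / α) * α = -1 := by field_simp
      rw [this, Real.rpow_neg_one]
      simp [hn'.ne']
    have h := (G.polyform_le_lam hα hx).trans (lam_le_lamP hG hα)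
    rw [polyform_const, hcard] at h
    refine le_trans (le_of_eq ?_) (mul_le_mul_of_nonneg_right h (by positivity))
    rw [mul_assoc, ← Real.rpow_natCast ((n : ℝ) ^ (-(1 / α))), ← Real.rpow_mul hn'.le,
      ← Real.rpow_add hn']
    have : -(1 / α) * r + (r / α - r) = -(r : ℝ) := by ring
    rw [this, Real.rpow_neg hn'.le, Real.rpow_natCast, div_eq_mul_inv]
  · have h0 : lamP α P n = 0 := by
      rw [Set.not_nonempty_iff_eq_empty] at hP
      simp [lamP, hP]
    simp [exP_eq_zero_of_not_nonempty hP, h0]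

lemma polyform_mul_rpow_le {r n m : ℕ} {P : ∀ n, Set (HGraph r n)} (hP : Hereditary P)
    {G : HGraph r n} (hG : G ∈ P n) (hr : 1 ≤ r) (hm : r ≤ m) (hn : 0 < n) {α : ℝ} (hα : 1 < α)
    {x : Fin n → ℝ} (hx : ∑ i, |x i| ^ α = 1) :
    G.polyform x * (n : ℝ) ^ ((r : ℝ) / α - r) ≤
      exDensity P m + (m : ℝ) ^ 2 * (n : ℝ) ^ (-(1 - 1 / α)) := by
  have hn' : (0 : ℝ) < n := by exact_mod_cast hn
  have hα0 : 0 < α := by linarith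
  obtain ⟨q, rfl⟩ : ∃ q, r = q + 1 := ⟨r - 1, by omega⟩
  set c : ℝ := (n : ℝ) ^ (1 - 1 / α) with hc
  have hc0 : 0 < c := by positivity
  set S : ℝ := ∑ i, |x i| with hS
  have hSnn : 0 ≤ S := Finset.sum_nonneg fun i _ => abs_nonneg _
  have hS0 : 0 < S := by
    refine hSnn.lt_of_ne fun h => ?_
    have hz := (Finset.sum_eq_zero_iff_of_nonneg fun i _ => abs_nonneg (x i)).1 h.symm
    rw [Finset.sum_congr rfl fun i hi => by rw [hz i hi, Real.zero_rpow hα0.ne']] at hx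
    simp at hx
  have hSc : S ≤ c := by
    rw [← Real.rpow_le_rpow_iff hSnn hc0.le hα0, hc, ← Real.rpow_mul hn'.le]
    have h := Real.rpow_sum_le_const_mul_sum_rpow univ x hα.le
    rw [hx, mul_one, Finset.card_univ, Fintype.card_fin] at h
    have he : (1 - 1 / α) * α = α - 1 := by field_simp
    rwa [he]
  have hw : ∑ i, S⁻¹ * |x i| = 1 := by
    rw [← Finset.mul_sum]
    exact inv_mul_cancel₀ hS0.ne'
  have hw0 (i : Fin n) : 0 ≤ S⁻¹ * |x i| := by positivity
  have hsq : ∑ i, (S⁻¹ * |x i|) ^ 2 ≤ S⁻¹ := by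
    calc ∑ i, (S⁻¹ * |x i|) ^ 2 ≤ ∑ i, S⁻¹ ^ 2 * |x i| := by
          refine Finset.sum_le_sum fun i _ => ?_
          rw [mul_pow]
          gcongr
          have := abs_le_one_of_sum_rpow_eq_one hα0 hx i
          nlinarith [abs_nonneg (x i)]
      _ = S⁻¹ := by
          rw [← Finset.mul_sum, ← hS]
          field_simp
  have hD := exDensity_nonneg P m
  have hpoly : G.polyform x ≤ c ^ (q + 1) * exDensity P m + (m : ℝ) ^ 2 * c ^ q := by
    calc G.polyform x ≤ G.polyform fun i => |x i| := G.polyform_le_polyform_abs x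
      _ = G.polyform fun i => S * (S⁻¹ * |x i|) := by
          congr 1
          funext i
          field_simp
      _ = S ^ (q + 1) * G.polyform fun i => S⁻¹ * |x i| := G.polyform_mul S _
      _ ≤ S ^ (q + 1) * (exDensity P m + (m : ℝ) ^ 2 * S⁻¹) := by
          gcongr
          exact (polyform_le_of_mem hP hG hm hw0 hw).trans (by gcongr)
      _ = S ^ (q + 1) * exDensity P m + (m : ℝ) ^ 2 * S ^ q := by
          field_simp
          ring
      _ ≤ _ := by gcongr
  have hexp : (n : ℝ) ^ (((q + 1 : ℕ) : ℝ) / α - (q + 1 : ℕ)) = (c ^ (q + 1))⁻¹ := by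
    rw [hc, ← Real.rpow_natCast, ← Real.rpow_mul hn'.le, ← Real.rpow_neg hn'.le]
    congr 1
    ring
  rw [hexp, Real.rpow_neg hn'.le, ← hc, ← div_eq_mul_inv, div_le_iff₀ (by positivity)]
  refine hpoly.trans_eq ?_
  field_simp
  ring

lemma lamP_mul_rpow_le {r n m : ℕ} {P : ∀ n, Set (HGraph r n)} (hP : Hereditary P)
    (hr : 1 ≤ r) (hm : r ≤ m) (hn : 0 < n) {α : ℝ} (hα : 1 < α) :
    lamP α P n * (n : ℝ) ^ ((r : ℝ) / α - r) ≤
      exDensity P m + (m : ℝ) ^ 2 * (n : ℝ) ^ (-(1 - 1 / α)) := by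
  have hn' : (0 : ℝ) < n := by exact_mod_cast hn
  have hpow : 0 < (n : ℝ) ^ ((r : ℝ) / α - r) := by positivity
  have hnn : 0 ≤ (exDensity P m + (m : ℝ) ^ 2 * (n : ℝ) ^ (-(1 - 1 / α))) /
      (n : ℝ) ^ ((r : ℝ) / α - r) := by
    have := exDensity_nonneg P m
    positivity
  rw [← le_div_iff₀ hpow]
  refine Real.sSup_le ?_ hnn
  rintro _ ⟨G, hG, rfl⟩
  refine Real.sSup_le ?_ hnn
  rintro _ ⟨x, hx, rfl⟩
  rw [le_div_iff₀ hpow]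
  exact polyform_mul_rpow_le hP hG hr hm hn hα hx

open Filter Topology

lemma tendsto_factorial_mul_choose_div (r : ℕ) :
    Tendsto (fun n : ℕ => (r.factorial : ℝ) * n.choose r / (n : ℝ) ^ r) atTop (𝓝 1) := by
  have h := (Asymptotics.isEquivalent_iff_tendsto_one (by
    filter_upwards [eventually_gt_atTop 0] with n hn
    have : (0 : ℝ) < n := by exact_mod_cast hn
    positivity)).1 (isEquivalent_choose r)
  refine h.congr fun n => ?_
  simp only [Pi.div_apply]
  rw [div_div_eq_mul_div, mul_comm]

lemma exDensity_mul_eq {r n : ℕ} (P : ∀ n, Set (HGraph r n)) (hn : r ≤ n) :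
    exDensity P n * ((r.factorial : ℝ) * n.choose r / (n : ℝ) ^ r) =
      r.factorial * exP P n / (n : ℝ) ^ r := by
  have hC : (0 : ℝ) < n.choose r := by exact_mod_cast Nat.choose_pos hn
  rw [exDensity]
  field_simp

/-- For `α > 1` and a hereditary property, `λ^(α)(P)` exists and equals the infimum of the
extremal densities. -/
lemma exists_tendsto_lamP {r : ℕ} (hr : 1 ≤ r) {P : ∀ n, Set (HGraph r n)} (hP : Hereditary P)
    {α : ℝ} (hα : 1 < α) :
    ∃ L : ℝ, IsGLB (exDensity P '' Set.Ici r) L ∧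
      Tendsto (fun n : ℕ => lamP α P n * (n : ℝ) ^ ((r : ℝ) / α - r)) atTop (𝓝 L) := by
  have hα0 : 0 < α := by linarith
  have hbdd : BddBelow (exDensity P '' Set.Ici r) :=
    ⟨0, by rintro _ ⟨m, -, rfl⟩; exact exDensity_nonneg P m⟩
  have hglb := Real.isGLB_sInf (Set.Nonempty.image (exDensity P) (Set.nonempty_Ici (a := r))) hbdd
  refine ⟨_, hglb, tendsto_order.2 ⟨fun a ha => ?_, fun a ha => ?_⟩⟩
  · set L := sInf (exDensity P '' Set.Ici r)
    have hq := (tendsto_factorial_mul_choose_div r).const_mul L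
    rw [mul_one] at hq
    filter_upwards [hq.eventually (eventually_gt_nhds ha), eventually_ge_atTop r,
      eventually_gt_atTop 0] with n hna hnr hn0
    calc a < L * ((r.factorial : ℝ) * n.choose r / (n : ℝ) ^ r) := hna
      _ ≤ exDensity P n * ((r.factorial : ℝ) * n.choose r / (n : ℝ) ^ r) := by
          gcongr
          exact hglb.1 ⟨n, hnr, rfl⟩
      _ = _ := exDensity_mul_eq P hnr
      _ ≤ _ := factorial_mul_exP_div_le P hα0 hn0
  · obtain ⟨_, ⟨m, hm, rfl⟩, -, hma⟩ := hglb.exists_between ha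
    have hexp : 0 < 1 - 1 / α := by
      rw [sub_pos, div_lt_one hα0]
      exact hα
    have h := (((tendsto_rpow_neg_atTop hexp).comp tendsto_natCast_atTop_atTop).const_mul
      ((m : ℝ) ^ 2)).const_add (exDensity P m)
    rw [mul_zero, add_zero] at h
    filter_upwards [h.eventually (eventually_lt_nhds hma), eventually_gt_atTop 0] with n hna hn0
    exact (lamP_mul_rpow_le hP hr hm hn0 hα).trans_lt hna

/-- Extremal densities for a blow-up of `H` are asymptotically at most those for `H`. -/
lemma eventually_exP_blowup_le {r h N : ℕ} (hr : 2 ≤ r) {H : HGraph r h} {k : Fin h → ℕ}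
    {B : HGraph r N} {φ : Fin N → Fin h} (hB : IsBlowup H k B φ) {m : ℕ} (hm : r ≤ m)
    {ε : ℝ} (hε : 0 < ε) :
    ∀ᶠ n : ℕ in atTop, r.factorial * exP (MonP B) n / (n : ℝ) ^ r ≤
      exDensity (MonP H) m + ε := by
  set K : ℝ := (Fintype.card (Fin h ↪ Fin m) : ℝ) with hK
  have hK0 : 0 ≤ K := by positivity
  obtain ⟨n₀, hn₀⟩ := exists_card_copies_lt hr hB (ε := ε / (2 * (K + 1))) (by positivity)
  have hlim := (tendsto_inv_atTop_nhds_zero_nat (𝕜 := ℝ)).const_mul ((m : ℝ) ^ 2)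
  rw [mul_zero] at hlim
  filter_upwards [eventually_ge_atTop n₀, eventually_gt_atTop 0,
    hlim.eventually (eventually_lt_nhds (half_pos hε))] with n hn hn0 hsmall
  have hn' : (0 : ℝ) < n := by exact_mod_cast hn0
  by_cases hP : (MonP B n).Nonempty
  · obtain ⟨G, hG, hcard⟩ := exists_card_edges_eq_exP hP
    have hpoly := polyform_le_copies H G hm (w := fun _ => (n : ℝ)⁻¹) (fun _ => by positivity)
      (by simp [hn'.ne'])
    rw [polyform_const, hcard, ← hK] at hpoly
    simp only [Finset.prod_const, Finset.sum_const, Finset.card_univ, Fintype.card_fin,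
      nsmul_eq_mul] at hpoly
    have hsq : (n : ℝ) * (n : ℝ)⁻¹ ^ 2 = (n : ℝ)⁻¹ := by field_simp
    have hcop : K * ((copies H G).card * (n : ℝ)⁻¹ ^ h) ≤ ε / 2 := by
      calc K * ((copies H G).card * (n : ℝ)⁻¹ ^ h)
          ≤ K * (ε / (2 * (K + 1)) * (n : ℝ) ^ h * (n : ℝ)⁻¹ ^ h) := by
            gcongr
            exact (hn₀ n hn G hG).le
        _ = K / (K + 1) * (ε / 2) := by
            rw [inv_pow]
            field_simp
        _ ≤ 1 * (ε / 2) := by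
            gcongr
            rw [div_le_one (by positivity)]
            linarith
        _ = ε / 2 := one_mul _
    rw [hsq] at hpoly
    rw [div_eq_mul_inv, ← inv_pow]
    linarith
  · have := exDensity_nonneg (MonP H) m
    rw [exP_eq_zero_of_not_nonempty hP]
    simp only [CharP.cast_eq_zero, mul_zero, zero_div]
    linarith

end HGraph

/-- Theorem on blow-ups: for `α > 1`, an `r`-graph `H` of order `h`
and a blow-up `H(k₁, …, k_h)` of `H`,
`λ^(α)(Mon(H)) = λ^(α)(Mon(H(k₁,…,k_h)))`. -/
theorem stmt12 {r h : ℕ} (hr : 2 ≤ r) (α : ℝ) (hα : 1 < α) (H : HGraph r h)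
    (k : Fin h → ℕ) (hk : ∀ i, 0 < k i) {N : ℕ} (B : HGraph r N)
    (φ : Fin N → Fin h) (hB : IsBlowup H k B φ) :
    ∃ L : ℝ,
      Filter.Tendsto (fun n : ℕ => lamP α (MonP H) n * (n : ℝ) ^ ((r : ℝ) / α - r))
        Filter.atTop (nhds L) ∧
      Filter.Tendsto (fun n : ℕ => lamP α (MonP B) n * (n : ℝ) ^ ((r : ℝ) / α - r))
        Filter.atTop (nhds L) := by
  obtain ⟨L, hL, hLt⟩ := exists_tendsto_lamP (by omega : 1 ≤ r) (hereditary_monP H) hα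
  obtain ⟨L', hL', hLt'⟩ := exists_tendsto_lamP (by omega : 1 ≤ r) (hereditary_monP B) hα
  have hle : L ≤ L' := by
    refine (le_isGLB_iff hL').2 ?_
    rintro _ ⟨m, hm, rfl⟩
    refine (hL.1 ⟨m, hm, rfl⟩).trans ?_
    unfold exDensity
    gcongr
    exact exP_le_exP (monP_subset_of_isBlowup hk hB m)
  have hge : L' ≤ L := by
    refine (le_isGLB_iff hL).2 ?_
    rintro _ ⟨m, hm, rfl⟩
    refine le_of_forall_pos_le_add fun ε hε => ?_
    have hq := (tendsto_factorial_mul_choose_div r).const_mul L'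
    rw [mul_one] at hq
    refine le_of_tendsto hq ?_
    filter_upwards [eventually_exP_blowup_le hr hB hm hε, Filter.eventually_ge_atTop r]
      with n hn hnr
    refine le_trans ?_ hn
    rw [← exDensity_mul_eq _ hnr]
    gcongr
    exact hL'.1 ⟨n, hnr, rfl⟩
  exact ⟨L, hLt, le_antisymm hle hge ▸ hLt'⟩
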